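/- Let F be a unitary N×N complex matrix and let z ∈ ℂ^N. Define s* ∈ {−1,1}^N by s*_i = sign( Re( (F z)_i ) ), where sign(t) = 1 if t ≥ 0 and −1 if t < 0. Then for every s ∈ {−1,1}^N, ‖Fᴴ s* − z‖₂ ≤ ‖Fᴴ s − z‖₂; i.e., s* minimizes ‖Fᴴ s − z‖₂² over all binary (±1) vectors s. -/

import Mathlib

open Matrix Finset

/-- `sign(t) = 1` if `t ≥ 0` and `-1` otherwise. -/
noncomputable def rsign (t : ℝ) : ℝ := if 0 ≤ t then 1 else -1

theorem rsign_sub_sq_le (t a : ℝ) (ha : a = 1 ∨ a = -1) :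
    (rsign t - t) ^ 2 ≤ (a - t) ^ 2 := by
  unfold rsign
  split_ifs <;> rcases ha with rfl | rfl <;> nlinarith

theorem sum_normSq_eq_dotProduct {ι : Type*} [Fintype ι] (v : ι → ℂ) :
    ((∑ i, Complex.normSq (v i) : ℝ) : ℂ) = star v ⬝ᵥ v := by
  simp [dotProduct, Complex.normSq_eq_conj_mul_self]

theorem sum_normSq_mulVec {m n : Type*} [Fintype m] [Fintype n] [DecidableEq n]
    (A : Matrix m n ℂ) (hA : A.conjTranspose * A = 1) (v : n → ℂ) :
    ∑ i, Complex.normSq (A.mulVec v i) = ∑ i, Complex.normSq (v i) := by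
  apply Complex.ofReal_injective
  rw [sum_normSq_eq_dotProduct, sum_normSq_eq_dotProduct, star_mulVec, ← dotProduct_mulVec,
    mulVec_mulVec, hA, one_mulVec]

theorem sum_normSq_conjTranspose_mulVec_sub {m n : Type*} [Fintype m] [Fintype n]
    [DecidableEq m] [DecidableEq n] (F : Matrix m n ℂ) (hF1 : F.conjTranspose * F = 1)
    (hF2 : F * F.conjTranspose = 1) (z : n → ℂ) (v : m → ℂ) :
    ∑ i, Complex.normSq (F.conjTranspose.mulVec v i - z i) =
      ∑ i, Complex.normSq (v i - F.mulVec z i) := by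
  have h := sum_normSq_mulVec F.conjTranspose (by rwa [conjTranspose_conjTranspose])
    (v - F.mulVec z)
  rw [mulVec_sub, mulVec_mulVec, hF1, one_mulVec] at h
  exact h

theorem shape_binary_update_optimal
    {N : ℕ}
    (F : Matrix (Fin N) (Fin N) ℂ)
    (hF1 : F.conjTranspose * F = 1) (hF2 : F * F.conjTranspose = 1)
    (z : Fin N → ℂ)
    (sstar : Fin N → ℝ)
    (hsstar : ∀ i, sstar i = rsign (F.mulVec z i).re) :
    ∀ s : Fin N → ℝ, (∀ i, s i = 1 ∨ s i = -1) →
      Real.sqrt (∑ i, Complex.normSq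
          (F.conjTranspose.mulVec (fun k => (sstar k : ℂ)) i - z i))
        ≤ Real.sqrt (∑ i, Complex.normSq
          (F.conjTranspose.mulVec (fun k => (s k : ℂ)) i - z i)) := by
  intro s hs
  rw [sum_normSq_conjTranspose_mulVec_sub F hF1 hF2, sum_normSq_conjTranspose_mulVec_sub F hF1 hF2]
  refine Real.sqrt_le_sqrt (Finset.sum_le_sum fun i _ => ?_)
  have h := rsign_sub_sq_le (F.mulVec z i).re (s i) (hs i)
  simp only [Complex.normSq_apply, Complex.sub_re, Complex.sub_im, Complex.ofReal_re,
    Complex.ofReal_im, hsstar i]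
  linarith
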